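/- Define N : ℝ² → ℝ by N(x₁,x₂) = √(x₁² + 2x₂²) + |x₂|. Then N is a norm on ℝ², and its closed unit ball {x ∈ ℝ² : N(x) ≤ 1} equals the intersection of the two Euclidean disks {x : x₁² + (x₂ − 1)² ≤ 2} and {x : x₁² + (x₂ + 1)² ≤ 2}. -/

import Mathlib

/-- The norm of the singular Minkowski plane. -/
noncomputable def singN (x : ℝ × ℝ) : ℝ :=
  Real.sqrt (x.1 ^ 2 + 2 * x.2 ^ 2) + |x.2|

theorem singN_nonneg (x : ℝ × ℝ) : 0 ≤ singN x := by
  unfold singN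
  positivity

theorem singN_eq_zero_iff (x : ℝ × ℝ) : singN x = 0 ↔ x = 0 := by
  obtain ⟨a, b⟩ := x
  simp only [singN, Prod.mk_eq_zero]
  constructor
  · intro h
    obtain ⟨hs, hb⟩ := (add_eq_zero_iff_of_nonneg (Real.sqrt_nonneg _) (abs_nonneg _)).1 h
    have hb := abs_eq_zero.1 hb
    subst hb
    rw [Real.sqrt_eq_zero (by positivity)] at hs
    simpa using hs
  · rintro ⟨rfl, rfl⟩
    simp

theorem singN_smul (c : ℝ) (x : ℝ × ℝ) : singN (c • x) = |c| * singN x := by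
  simp only [singN, Prod.smul_fst, Prod.smul_snd, smul_eq_mul, abs_mul]
  rw [show (c * x.1) ^ 2 + 2 * (c * x.2) ^ 2 = c ^ 2 * (x.1 ^ 2 + 2 * x.2 ^ 2) by ring,
    Real.sqrt_mul (sq_nonneg c), Real.sqrt_sq_eq_abs, mul_add]

theorem singN_add_le (x y : ℝ × ℝ) : singN (x + y) ≤ singN x + singN y := by
  obtain ⟨a, b⟩ := x
  obtain ⟨c, d⟩ := y
  simp only [singN, Prod.mk_add_mk]
  have hs : Real.sqrt ((a + c) ^ 2 + 2 * (b + d) ^ 2) ≤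
      Real.sqrt (a ^ 2 + 2 * b ^ 2) + Real.sqrt (c ^ 2 + 2 * d ^ 2) := by
    have cauchy : a * c + 2 * (b * d) ≤
        Real.sqrt (a ^ 2 + 2 * b ^ 2) * Real.sqrt (c ^ 2 + 2 * d ^ 2) := by
      rw [← Real.sqrt_mul (by positivity)]
      apply Real.le_sqrt_of_sq_le
      nlinarith [sq_nonneg (a * d - b * c)]
    rw [Real.sqrt_le_left (by positivity), add_sq (Real.sqrt _), Real.sq_sqrt (by positivity),
      Real.sq_sqrt (by positivity)]
    linarith
  linarith [abs_add_le b d]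

theorem singN_le_one_iff (x : ℝ × ℝ) :
    singN x ≤ 1 ↔ x.1 ^ 2 + (x.2 - 1) ^ 2 ≤ 2 ∧ x.1 ^ 2 + (x.2 + 1) ^ 2 ≤ 2 := by
  obtain ⟨a, b⟩ := x
  simp only [singN]
  rw [← le_sub_iff_add_le, Real.sqrt_le_iff]
  constructor
  · rintro ⟨-, h⟩
    constructor <;> nlinarith [sq_abs b, le_abs_self b, neg_abs_le b]
  · rintro ⟨h₁, h₂⟩
    rcases abs_cases b with ⟨hb, -⟩ | ⟨hb, -⟩ <;> rw [hb] <;> constructor <;> nlinarith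

/-- `singN` is a norm on `ℝ²` and its closed unit ball is the intersection of the two
Euclidean disks `x₁² + (x₂ - 1)² ≤ 2` and `x₁² + (x₂ + 1)² ≤ 2`. -/
theorem singN_is_norm_and_unit_ball :
    (∀ x : ℝ × ℝ, 0 ≤ singN x) ∧
    (∀ x : ℝ × ℝ, singN x = 0 ↔ x = 0) ∧
    (∀ (c : ℝ) (x : ℝ × ℝ), singN (c • x) = |c| * singN x) ∧
    (∀ x y : ℝ × ℝ, singN (x + y) ≤ singN x + singN y) ∧
    {x : ℝ × ℝ | singN x ≤ 1} =
      {x : ℝ × ℝ | x.1 ^ 2 + (x.2 - 1) ^ 2 ≤ 2} ∩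
        {x : ℝ × ℝ | x.1 ^ 2 + (x.2 + 1) ^ 2 ≤ 2} := by
  exact ⟨singN_nonneg, singN_eq_zero_iff, singN_smul, singN_add_le,
    Set.ext singN_le_one_iff⟩
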